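/- arXiv:0912.0620 — 3 statements merged into one kernel-verified Lean document; each statement's English description precedes it below -/
import Mathlib

section
/- Let s_n = 64^n·((1/4)_n)^2/(n!)^2. For every prime p ≡ 1 (mod 4) and every positive integer n, s_{np} ≡ s_n (mod p^2). -/
open Finset Nat in
/-- `(2n)! = 2^n n! (2n-1)!!`, the double factorial being written as a product. -/
lemma factorial_two_mul_eq_prod_odd (n : ℕ) :
    (2 * n)! = 2 ^ n * n ! * ∏ j ∈ range n, (2 * j + 1) := by
  induction n with
  | zero => simp
  | succ n ih =>
    rw [show 2 * (n + 1) = 2 * n + 1 + 1 by ring, factorial_succ, factorial_succ, ih,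
      prod_range_succ, factorial_succ]
    ring

open Finset in
lemma prod_range_two_mul_eq_prod_mul_reflect {M : Type*} [CommMonoid M] (f : ℕ → M) (n : ℕ) :
    ∏ i ∈ range (2 * n), f i = ∏ i ∈ range n, (f i * f (2 * n - 1 - i)) := by
  rw [two_mul, prod_range_add, prod_mul_distrib, ← prod_range_reflect (fun i => f (n + i))]
  congr 1
  refine prod_congr rfl fun i hi => ?_
  rw [mem_range] at hi
  congr 1
  omega

open Finset Nat in
lemma factorial_mul_prod_sub {R : Type*} [CommRing R] (a b : ℕ) :
    ((a ! : ℕ) : R) * ∏ j ∈ range b, ((a + b + 1 : R) - (j + 1)) = ((a + b)! : ℕ) := by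
  rw [← factorial_mul_ascFactorial, ascFactorial_eq_prod_range, ← prod_range_reflect]
  push_cast
  congr 1
  refine prod_congr rfl fun i hi => ?_
  rw [mem_range] at hi
  rw [show b - 1 - i = b - (i + 1) by omega, Nat.cast_sub (by omega)]
  push_cast
  ring

open Finset in
lemma prod_odd_mul_prod_sub {R : Type*} [CommRing R] (a b : ℕ) :
    (∏ j ∈ range a, (2 * j + 1 : R)) * ∏ j ∈ range b, ((2 * (a + b) + 1 : R) - 2 * (j + 1)) =
      ∏ j ∈ range (a + b), (2 * j + 1 : R) := by
  rw [prod_range_add, ← prod_range_reflect (fun x => (2 * ((a + x : ℕ) : R) + 1))]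
  congr 1
  refine prod_congr rfl fun i hi => ?_
  rw [mem_range] at hi
  rw [show a + (b - 1 - i) = a + b - (i + 1) by omega, Nat.cast_sub (by omega)]
  push_cast
  ring

open Finset Nat in
/-- If `p ^ 2 = 0`, then `(∏_{j ≤ n} (p - 2j))^2 = (-4)^n n! ∏_{j ≤ n} (p - j)`. -/
lemma prod_sub_two_mul_sq {R : Type*} [CommRing R] {p : R} (hp : p ^ 2 = 0) (n : ℕ) :
    (∏ j ∈ range n, (p - 2 * (j + 1))) ^ 2 =
      (-4) ^ n * (n ! : ℕ) * ∏ j ∈ range n, (p - (j + 1)) := by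
  induction n with
  | zero => simp
  | succ n ih =>
    rw [prod_range_succ, mul_pow, ih, prod_range_succ, factorial_succ]
    push_cast
    linear_combination (-4) ^ n * (n ! : ℕ) * (∏ j ∈ range n, (p - (j + 1))) * hp

open Finset Nat in
/-- The congruence `∏_{j ≤ q} (p - j) ≡ (-1)^q 8^(p-1) q!` modulo `p ^ 2`, where `p = 4q + 1`. -/
lemma prod_sub_eq_of_sq_eq_zero {R : Type*} [CommRing R] {q : ℕ} (hq : 0 < q)
    (hp : (4 * q + 1 : R) ^ 2 = 0) (hu : IsUnit (((4 * q)! : ℕ) : R)) :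
    ∏ j ∈ range q, ((4 * q + 1 : R) - (j + 1)) = (-1) ^ q * 8 ^ (4 * q) * (q ! : ℕ) := by
  have unit_of_dvd {d : ℕ} (h : d ∣ (4 * q)!) : IsUnit (d : R) :=
    isUnit_of_dvd_unit (Nat.cast_dvd_cast h) hu
  have u1 : IsUnit ((q ! : ℕ) : R) := unit_of_dvd (factorial_dvd_factorial (by omega))
  have u2 : IsUnit (((2 * q)! : ℕ) : R) := unit_of_dvd (factorial_dvd_factorial (by omega))
  have u3 : IsUnit (2 : R) := by
    exact_mod_cast unit_of_dvd (Nat.dvd_factorial two_pos (by omega))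
  have f4 := congrArg (Nat.cast (R := R)) (factorial_two_mul_eq_prod_odd (2 * q))
  have f2 := congrArg (Nat.cast (R := R)) (factorial_two_mul_eq_prod_odd q)
  have uO : IsUnit (∏ j ∈ range (2 * q), (2 * j + 1 : R)) := by
    have h : ∏ j ∈ range (2 * q), (2 * j + 1) ∣ (2 * (2 * q))! :=
      ⟨_, (factorial_two_mul_eq_prod_odd (2 * q)).trans (mul_comm _ _)⟩
    rw [show 2 * (2 * q) = 4 * q by ring] at h
    exact_mod_cast unit_of_dvd h
  have o2 := prod_odd_mul_prod_sub (R := R) 0 (2 * q)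
  have o1 := prod_odd_mul_prod_sub (R := R) q q
  have g2 := factorial_mul_prod_sub (R := R) (2 * q) (2 * q)
  have s2 := prod_sub_two_mul_sq hp (2 * q)
  have s1 := prod_sub_two_mul_sq hp q
  rw [show 2 * q + 2 * q = 2 * (2 * q) by ring] at g2
  rw [zero_add] at o2
  push_cast at f4 f2 o1 o2 g2
  simp only [range_zero, prod_empty, one_mul, zero_add] at o2
  rw [show (2 * q + 2 * q + 1 : R) = 4 * q + 1 by ring] at g2
  rw [show (2 * (2 * q) + 1 : R) = 4 * q + 1 by ring] at o2
  rw [show (2 * (q + q) + 1 : R) = 4 * q + 1 by ring, ← two_mul] at o1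
  rw [o2] at s2
  rw [f4] at g2
  set O2 := ∏ j ∈ range (2 * q), (2 * j + 1 : R)
  set O1 := ∏ j ∈ range q, (2 * j + 1 : R)
  set P1 := ∏ j ∈ range q, ((4 * q + 1 : R) - 2 * (j + 1))
  set Q1 := ∏ j ∈ range q, ((4 * q + 1 : R) - (j + 1))
  set Q2 := ∏ j ∈ range (2 * q), ((4 * q + 1 : R) - (j + 1))
  have e4 : (-4 : R) ^ (2 * q) = 2 ^ (4 * q) := by
    rw [pow_mul, show (-4 : R) ^ 2 = 2 ^ 4 by norm_num, ← pow_mul]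
  have hQ2 : Q2 = 2 ^ (2 * q) * O2 := u2.mul_left_cancel (by rw [g2]; ring)
  have hO2 : O2 = 2 ^ (6 * q) * ((2 * q)! : ℕ) := uO.mul_left_cancel (by
    rw [← sq, s2, e4, hQ2]; ring)
  have hP1 : P1 = 2 ^ (7 * q) * (q ! : ℕ) := u2.mul_left_cancel (by
    calc _ = 2 ^ q * (q ! : ℕ) * (O1 * P1) := by rw [f2]; ring
      _ = _ := by rw [o1, hO2]; ring)
  have e3 : (-4 : R) ^ q = (-1) ^ q * 2 ^ (2 * q) := by
    rw [pow_mul, ← mul_pow]; norm_num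
  have e8 : (8 : R) ^ (4 * q) = 2 ^ (12 * q) := by
    rw [show (8 : R) = 2 ^ 3 by norm_num, ← pow_mul]; ring
  rw [hP1, e3] at s1
  have hsign : ((-1 : R) ^ q) * (-1) ^ q = 1 := by rw [← mul_pow]; simp
  refine ((u3.pow (2 * q)).mul u1).mul_left_cancel ?_
  rw [e8]
  linear_combination (-(-1) ^ q) * s1 - (2 ^ (2 * q) * (q ! : ℕ) * Q1) * hsign

open Finset Nat in
/-- One block of the comparison of `2^(p-1) ∏ (4i + 1)` with `∏ k` modulo `p ^ 2`, over
`p = 4q + 1` consecutive indices, the multiples of `p` being left out. -/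
lemma prod_block_eq_of_sq_eq_zero {R : Type*} [CommRing R] {q : ℕ} (hq : 0 < q)
    (hp : (4 * q + 1 : R) ^ 2 = 0) (hu : IsUnit (((4 * q)! : ℕ) : R)) (m : R) :
    2 ^ (4 * q) * ((∏ j ∈ range q, ((4 * q + 1) * (4 * m + 1) - 4 * (j + 1))) *
      ∏ j ∈ range (3 * q), ((4 * q + 1) * (4 * m + 1) + 4 * (j + 1))) =
      ∏ i ∈ range (4 * q), ((4 * q + 1) * m + (i + 1)) := by
  have hV : ∏ i ∈ range (4 * q), ((4 * q + 1) * m + (i + 1)) = (((4 * q)! : ℕ) : R) := by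
    rw [← prod_range_add_one_eq_factorial, show 4 * q = 2 * (2 * q) by ring]
    push_cast
    rw [prod_range_two_mul_eq_prod_mul_reflect _ (2 * q),
      prod_range_two_mul_eq_prod_mul_reflect _ (2 * q)]
    refine prod_congr rfl fun i hi => ?_
    rw [mem_range] at hi
    rw [show 2 * (2 * q) - 1 - i = 2 * (2 * q) - (i + 1) by omega, Nat.cast_sub (by omega)]
    push_cast
    linear_combination (m ^ 2 + m) * hp
  have hU : (∏ j ∈ range q, ((4 * q + 1) * (4 * m + 1) - 4 * (j + 1))) *
      ∏ j ∈ range (3 * q), ((4 * q + 1) * (4 * m + 1) + 4 * (j + 1)) =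
      (-1) ^ q * 4 ^ (4 * q) * (q ! : ℕ) * (((3 * q)! : ℕ) : R) := by
    have hmid : ∏ j ∈ range (2 * q), ((4 * q + 1) * (4 * m + 1) + 4 * (((q + j : ℕ) : R) + 1)) =
        ∏ j ∈ range (2 * q), 4 * (((q + j : ℕ) : R) + 1) := by
      rw [prod_range_two_mul_eq_prod_mul_reflect, prod_range_two_mul_eq_prod_mul_reflect]
      refine prod_congr rfl fun i hi => ?_
      rw [mem_range] at hi
      rw [show q + (2 * q - 1 - i) = 3 * q - (i + 1) by omega, Nat.cast_sub (by omega)]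
      push_cast
      linear_combination ((4 * m + 1) ^ 2 + 4 * (4 * m + 1)) * hp
    have hlow : (∏ j ∈ range q, ((4 * q + 1) * (4 * m + 1) - 4 * (j + 1))) *
        ∏ j ∈ range q, ((4 * q + 1) * (4 * m + 1) + 4 * (j + 1)) =
        (-1) ^ q * 4 ^ q * (q ! : ℕ) * ∏ j ∈ range q, (4 * ((j : R) + 1)) := by
      rw [← prod_range_add_one_eq_factorial, ← prod_mul_distrib, ← mul_pow]
      push_cast
      rw [← card_range q, ← prod_const, card_range, ← prod_mul_distrib, ← prod_mul_distrib]
      refine prod_congr rfl fun i _ => ?_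
      linear_combination (4 * m + 1) ^ 2 * hp
    have hall : ∏ j ∈ range (3 * q), (4 * ((j : R) + 1)) = 4 ^ (3 * q) * ((3 * q)! : ℕ) := by
      rw [prod_mul_distrib, prod_const, card_range, ← prod_range_add_one_eq_factorial]
      push_cast
      rfl
    rw [show 3 * q = q + 2 * q by ring, prod_range_add] at hall ⊢
    rw [hmid, ← mul_assoc, hlow, mul_assoc, hall]
    ring
  have hfac := factorial_mul_prod_sub (R := R) (3 * q) q
  rw [show 3 * q + q = 4 * q by ring] at hfac
  push_cast at hfac
  rw [show (3 * q + q + 1 : R) = 4 * q + 1 by ring, prod_sub_eq_of_sq_eq_zero hq hp hu] at hfac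
  rw [hU, hV, ← hfac, show (8 : R) = 2 * 4 by norm_num, mul_pow]
  ring

open Finset in
/-- The product of `4i + 1` over `p = 4q + 1` consecutive indices contains exactly one multiple
of `p`. -/
lemma prod_four_mul_add_one_block (q n : ℕ) :
    ∏ r ∈ range (4 * q + 1), (4 * ((n * (4 * q + 1) + r : ℕ) : ℤ) + 1) =
      (4 * q + 1) * (4 * n + 1) *
        ((∏ j ∈ range q, ((4 * q + 1) * (4 * n + 1) - 4 * (j + 1) : ℤ)) *
          ∏ j ∈ range (3 * q), ((4 * q + 1) * (4 * n + 1) + 4 * (j + 1) : ℤ)) := by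
  rw [show 4 * q + 1 = q + (3 * q + 1) by ring, prod_range_add, prod_range_succ',
    ← prod_range_reflect]
  have h1 : ∏ j ∈ range q, (4 * ((n * (q + (3 * q + 1)) + (q - 1 - j) : ℕ) : ℤ) + 1) =
      ∏ j ∈ range q, ((4 * q + 1) * (4 * n + 1) - 4 * (j + 1) : ℤ) := by
    refine prod_congr rfl fun i hi => ?_
    rw [mem_range] at hi
    rw [show q - 1 - i = q - (i + 1) by omega]
    push_cast [Nat.cast_sub (show i + 1 ≤ q by omega)]
    ring
  have h2 : ∏ j ∈ range (3 * q), (4 * ((n * (q + (3 * q + 1)) + (q + (j + 1)) : ℕ) : ℤ) + 1) =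
      ∏ j ∈ range (3 * q), ((4 * q + 1) * (4 * n + 1) + 4 * (j + 1) : ℤ) := by
    refine prod_congr rfl fun i _ => ?_
    push_cast
    ring
  rw [h1, h2]
  push_cast
  ring

open Finset Nat in
/-- The `p`-free parts `V` of `(np)!` and `U` of `∏_{i < np} (4i + 1)` satisfy
`2^(n(p-1)) U ≡ V` modulo `p ^ 2`. -/
lemma exists_prime_free_parts {q : ℕ} (hp : (4 * q + 1).Prime) (n : ℕ) :
    ∃ U V : ℤ, (((n * (4 * q + 1))! : ℕ) : ℤ) = (4 * q + 1) ^ n * (n ! : ℕ) * V ∧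
      ∏ i ∈ range (n * (4 * q + 1)), (4 * i + 1 : ℤ) =
        (4 * q + 1) ^ n * (∏ i ∈ range n, (4 * i + 1 : ℤ)) * U ∧
      ¬ ((4 * q + 1 : ℕ) : ℤ) ∣ V ∧
      (((4 * q + 1) ^ 2 : ℕ) : ℤ) ∣ 2 ^ (n * (4 * q)) * U - V := by
  have hq : 0 < q := by
    rcases Nat.eq_zero_or_pos q with rfl | h
    · exact absurd hp (by norm_num)
    · exact h
  have hpZ := Nat.prime_iff_prime_int.mp hp
  induction n with
  | zero => exact ⟨1, 1, by simp, by simp, hpZ.not_dvd_one, by simp⟩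
  | succ n ih =>
    obtain ⟨U, V, hV, hU, hpV, hUV⟩ := ih
    refine ⟨U * ((∏ j ∈ range q, ((4 * q + 1) * (4 * n + 1) - 4 * (j + 1) : ℤ)) *
          ∏ j ∈ range (3 * q), ((4 * q + 1) * (4 * n + 1) + 4 * (j + 1) : ℤ)),
        V * ∏ i ∈ range (4 * q), ((4 * q + 1) * n + (i + 1) : ℤ), ?_, ?_, ?_, ?_⟩
    · rw [show (n + 1) * (4 * q + 1) = n * (4 * q + 1) + (4 * q + 1) by ring,
        ← factorial_mul_ascFactorial, ascFactorial_eq_prod_range, prod_range_succ,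
        factorial_succ]
      push_cast
      rw [hV, pow_succ, mul_comm (n : ℤ)]
      simp only [add_assoc, add_comm (1 : ℤ)]
      ring
    · rw [show (n + 1) * (4 * q + 1) = n * (4 * q + 1) + (4 * q + 1) by ring, prod_range_add,
        hU, prod_four_mul_add_one_block, prod_range_succ]
      ring
    · refine fun h => (hpZ.dvd_or_dvd h).elim hpV fun h => ?_
      obtain ⟨i, hi, hdvd⟩ := (hpZ.dvd_finsetProd_iff _).mp h
      rw [mem_range] at hi
      push_cast at hdvd
      have h' : ((4 * q + 1 : ℕ) : ℤ) ∣ ((i + 1 : ℕ) : ℤ) := by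
        push_cast
        exact (dvd_add_right (dvd_mul_right _ _)).mp hdvd
      have := Nat.le_of_dvd (by omega) (Int.natCast_dvd_natCast.mp h')
      omega
    · have hsq : (4 * (q : ZMod ((4 * q + 1) ^ 2)) + 1) ^ 2 = 0 := by
        exact_mod_cast ZMod.natCast_self ((4 * q + 1) ^ 2)
      have hu : IsUnit (((4 * q)! : ℕ) : ZMod ((4 * q + 1) ^ 2)) := by
        rw [ZMod.isUnit_iff_coprime]
        exact (hp.coprime_factorial_of_lt (lt_add_one _)).symm.pow_right 2
      rw [← ZMod.intCast_zmod_eq_zero_iff_dvd] at hUV ⊢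
      have key := prod_block_eq_of_sq_eq_zero hq hsq hu (n : ZMod ((4 * q + 1) ^ 2))
      push_cast at hUV ⊢
      rw [← key, add_mul, one_mul, pow_add]
      linear_combination (2 ^ (4 * q) * ((∏ j ∈ range q,
        ((4 * q + 1) * (4 * n + 1) - 4 * (j + 1) : ZMod ((4 * q + 1) ^ 2))) *
          ∏ j ∈ range (3 * q), ((4 * q + 1) * (4 * n + 1) + 4 * (j + 1)))) * hUV

open Finset in
lemma four_pow_mul_ascPochhammer_eval (m : ℕ) :
    (4 : ℚ) ^ m * (ascPochhammer ℚ m).eval (1 / 4) = ∏ i ∈ range m, (4 * i + 1 : ℚ) := by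
  induction m with
  | zero => simp
  | succ m ih =>
    rw [ascPochhammer_succ_eval, prod_range_succ, ← ih]
    ring

/-- `(a)_n / n!` is `p`-integral for `p`-integral rational `a`. -/
lemma padicNorm_ascPochhammer_div_factorial_le_one (p : ℕ) [Fact p.Prime] {a : ℚ}
    (ha : padicNorm p a ≤ 1) (m : ℕ) :
    padicNorm p ((ascPochhammer ℚ m).eval a / m.factorial) ≤ 1 := by
  have hnorm : ‖(a : ℚ_[p])‖ ≤ 1 := by
    rw [Padic.eq_padicNorm]
    exact_mod_cast ha
  let x : ℤ_[p] := ⟨a, hnorm⟩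
  have h : (m.factorial : ℤ_[p]) * Ring.multichoose x m = (ascPochhammer ℤ_[p] m).eval x := by
    rw [← Polynomial.ascPochhammer_smeval_eq_eval, ← nsmul_eq_mul]
    exact Ring.factorial_nsmul_multichoose_eq_ascPochhammer x m
  have hx : (((ascPochhammer ℚ m).eval a / m.factorial : ℚ) : ℚ_[p]) = Ring.multichoose x m := by
    have hm : (m.factorial : ℚ_[p]) ≠ 0 := mod_cast m.factorial_ne_zero
    have h' := congrArg (PadicInt.Coe.ringHom (p := p)) h
    rw [map_mul, map_natCast, ← Polynomial.eval₂_at_apply, ← ascPochhammer_eval₂] at h'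
    rw [Rat.cast_div, Rat.cast_natCast, div_eq_iff hm, mul_comm]
    refine Eq.trans ?_ h'.symm
    rw [← eq_ratCast (Rat.castHom ℚ_[p]), ← Polynomial.eval₂_at_apply, ← ascPochhammer_eval₂]
    rfl
  have hle := PadicInt.norm_le_one (Ring.multichoose x m)
  rw [PadicInt.norm_def, ← hx, Padic.eq_padicNorm] at hle
  exact_mod_cast hle

/-- Let `s_n = 64^n ((1/4)_n)^2/(n!)^2`. For every prime `p ≡ 1 (mod 4)` and
every positive integer `n`, `s_{np} ≡ s_n (mod p^2)`. -/
theorem s_np_cong (p : ℕ) (hp : p.Prime) (h4 : p % 4 = 1) (n : ℕ) (hn : 0 < n)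
    (s : ℕ → ℚ)
    (hs : ∀ m, s m = (64 : ℚ) ^ m * ((ascPochhammer ℚ m).eval (1/4)) ^ 2 / (m.factorial : ℚ) ^ 2) :
    padicNorm p (s (n * p) - s n) ≤ (p : ℚ) ^ (-(2 : ℤ)) := by
  have : Fact p.Prime := ⟨hp⟩
  obtain ⟨q, rfl⟩ : ∃ q, p = 4 * q + 1 := ⟨p / 4, by omega⟩
  obtain ⟨U, V, hV, hU, hpV, hUV⟩ := exists_prime_free_parts hp n
  set p := 4 * q + 1 with hpq
  have hpQ : (p : ℚ) ≠ 0 := mod_cast hp.ne_zero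
  have hVQ := congrArg (Int.cast (R := ℚ)) hV
  have hUQ := congrArg (Int.cast (R := ℚ)) hU
  push_cast at hVQ hUQ
  rw [show (4 * q + 1 : ℚ) = p by rw [hpq]; push_cast; rfl] at hVQ hUQ
  have hs' (m : ℕ) : s m * (m.factorial : ℚ) ^ 2 =
      (2 ^ m * ∏ i ∈ Finset.range m, (4 * i + 1 : ℚ)) ^ 2 := by
    have hm : (m.factorial : ℚ) ≠ 0 := mod_cast m.factorial_ne_zero
    rw [← four_pow_mul_ascPochhammer_eval, ← mul_assoc, ← mul_pow, hs,
      div_mul_cancel₀ _ (pow_ne_zero 2 hm), mul_pow, ← pow_mul, mul_comm m, pow_mul]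
    norm_num
  have hsn : padicNorm p (s n) ≤ 1 := by
    have h4 : padicNorm p (1 / 4) ≤ 1 := by
      have : padicNorm p (4 : ℕ) = 1 := by
        rw [padicNorm.nat_eq_one_iff]
        intro h
        have := (Nat.coprime_primes hp Nat.prime_two).mpr (by omega)
        exact hp.one_lt.ne' ((this.pow_right 2).eq_one_of_dvd h)
      rw [padicNorm.div, padicNorm.one]
      rw [Nat.cast_ofNat] at this
      rw [this, div_one]
    have h := padicNorm_ascPochhammer_div_factorial_le_one p h4 n
    have h64 := padicNorm.of_nat (p := p) (64 ^ n)
    push_cast at h64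
    rw [hs, mul_div_assoc, ← div_pow, padicNorm.mul, sq, padicNorm.mul]
    exact mul_le_one₀ h64 (mul_nonneg (padicNorm.nonneg _) (padicNorm.nonneg _))
      (mul_le_one₀ h (padicNorm.nonneg _) h)
  have hrel : s (n * p) * (V : ℚ) ^ 2 = s n * (2 ^ (n * (4 * q)) * U) ^ 2 := by
    have hnf : (n.factorial : ℚ) ≠ 0 := mod_cast n.factorial_ne_zero
    have hc : ((p : ℚ) ^ n * n.factorial) ^ 2 ≠ 0 := by positivity
    refine mul_right_cancel₀ hc ?_
    have h1 := hs' (n * p)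
    rw [hVQ, hUQ, show n * p = n * (4 * q) + n by rw [hpq]; ring, pow_add] at h1
    rw [show n * p = n * (4 * q) + n by rw [hpq]; ring]
    linear_combination h1 - (2 ^ (n * (4 * q)) * U * (p : ℚ) ^ n) ^ 2 * hs' n
  have hdiff : (s (n * p) - s n) * (V : ℚ) ^ 2 =
      s n * ((2 ^ (n * (4 * q)) * U - V) * (2 ^ (n * (4 * q)) * U + V) : ℤ) := by
    push_cast
    linear_combination hrel
  have hnorm := congrArg (padicNorm p) hdiff
  have hV1 : padicNorm p V = 1 := (padicNorm.int_eq_one_iff V).mpr hpV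
  rw [padicNorm.mul, sq, padicNorm.mul, hV1, mul_one, mul_one, padicNorm.mul] at hnorm
  rw [hnorm]
  have hle := padicNorm.dvd_iff_norm_le.mp (hUV.mul_right (2 ^ (n * (4 * q)) * U + V))
  exact (mul_le_of_le_one_left (padicNorm.nonneg _) hsn).trans hle
end

section
/- For every prime p with p ≡ 1 (mod 6), 4^p · (1/6)_p ≡ (2/3)_p (mod p^3), i.e., the rational number 4^p·(1/6)_p − (2/3)_p has p-adic valuation at least 3. -/
open Finset

/-- A finite product `∏ (x + j)`, `1 ≤ j ≤ n`, to first order in `x`. -/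
theorem prod_add_natCast_eq_of_sq_eq_zero {R : Type*} [CommRing R] {N : ℕ} {i : ℕ → R}
    (hi : ∀ k, 1 ≤ k → k ≤ N → (k : R) * i k = 1) {x : R} (hx : x ^ 2 = 0) {n : ℕ} (hn : n ≤ N) :
    ∏ j ∈ range n, (x + (j + 1)) = (n.factorial : R) * (1 + x * ∑ j ∈ range n, i (j + 1)) := by
  induction n with
  | zero => simp
  | succ n ih =>
    have h := hi (n + 1) (by omega) hn
    rw [prod_range_succ, ih (by omega), sum_range_succ, Nat.factorial_succ]
    push_cast at h ⊢
    linear_combination (n.factorial : R) * (∑ j ∈ range n, i (j + 1)) * hx -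
      (n.factorial : R) * x * h

/-- The scaled version `∏ (a - b * j)`, `1 ≤ j ≤ n`, to first order in `a`. -/
theorem prod_sub_mul_natCast_eq_of_sq_eq_zero {R : Type*} [CommRing R] {N : ℕ} {i : ℕ → R}
    (hi : ∀ k, 1 ≤ k → k ≤ N → (k : R) * i k = 1) {a b c : R} (hbc : b * c = 1) (ha : a ^ 2 = 0)
    {n : ℕ} (hn : n ≤ N) :
    ∏ j ∈ range n, (a - b * (j + 1)) =
      (-b) ^ n * ((n.factorial : R) * (1 - c * a * ∑ j ∈ range n, i (j + 1))) := by
  have hx : (-(c * a)) ^ 2 = 0 := by linear_combination c ^ 2 * ha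
  rw [sub_eq_add_neg, ← neg_mul, ← prod_add_natCast_eq_of_sq_eq_zero hi hx hn]
  conv_rhs => rw [← card_range n, ← prod_const, card_range, ← prod_mul_distrib]
  refine prod_congr rfl fun j _ ↦ ?_
  linear_combination -a * hbc

theorem prod_succ_sub_mul_factorial {R : Type*} [CommRing R] {N n : ℕ} (hn : n ≤ N) :
    (∏ j ∈ range n, ((N + 1 : R) - (j + 1))) * ((N - n).factorial : R) = (N.factorial : R) := by
  induction n with
  | zero => simp
  | succ n ih =>
    rw [← ih (by omega), prod_range_succ]
    obtain ⟨r, rfl⟩ := Nat.exists_eq_add_of_le hn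
    rw [show n + 1 + r - (n + 1) = r by omega, show n + 1 + r - n = r + 1 by omega,
      Nat.factorial_succ]
    push_cast
    ring

theorem factorial_two_mul_eq_prod {R : Type*} [CommRing R] (n : ℕ) :
    ((2 * n).factorial : R) =
      2 ^ n * (n.factorial : R) * ∏ j ∈ range n, ((2 * n + 1 : R) - 2 * (j + 1)) := by
  have h : ((2 * n).factorial : R) =
      2 ^ n * (n.factorial : R) * ∏ j ∈ range n, (2 * (j : R) + 1) := by
    induction n with
    | zero => simp
    | succ n ih =>
      rw [show 2 * (n + 1) = 2 * n + 1 + 1 by ring, Nat.factorial_succ, Nat.factorial_succ,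
        Nat.factorial_succ, prod_range_succ]
      push_cast
      rw [ih]
      ring
  rw [h, ← prod_range_reflect]
  congr 1
  refine prod_congr rfl fun j hj ↦ ?_
  obtain ⟨r, rfl⟩ := Nat.exists_eq_add_of_lt (mem_range.mp hj)
  rw [show j + r + 1 - 1 - j = r by omega]
  push_cast
  ring

section

variable {R : Type*} [CommRing R] {N : ℕ} {i : ℕ → R}

theorem mul_inv_succ_sub (hi : ∀ k, 1 ≤ k → k ≤ N → (k : R) * i k = 1)
    (he : ((N : R) + 1) ^ 2 = 0) {k l : ℕ} (hk : 1 ≤ k) (hl : 1 ≤ l) (hkl : k + l = N + 1) :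
    ((N : R) + 1) * i k = -(((N : R) + 1) * i l) := by
  have h1 := hi k hk (by omega)
  have h2 := hi l hl (by omega)
  have h3 : (k : R) + l = N + 1 := by exact_mod_cast congrArg (Nat.cast (R := R)) hkl
  linear_combination (-(N + 1 : R) * i k) * h2 - ((N + 1 : R) * i l) * h1 +
    ((N + 1 : R) * i k * i l) * h3 + i k * i l * he

theorem mul_harmonic_sub (hi : ∀ k, 1 ≤ k → k ≤ N → (k : R) * i k = 1) (hN : 2 ≤ N)
    (he : ((N : R) + 1) ^ 2 = 0) {n : ℕ} (hn : n ≤ N) :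
    ((N : R) + 1) * ∑ j ∈ range (N - n), i (j + 1) =
      ((N : R) + 1) * ∑ j ∈ range n, i (j + 1) := by
  have key : ∀ n ≤ N, ((N : R) + 1) * ∑ j ∈ range (N - n), i (j + 1) =
      ((N : R) + 1) * ∑ j ∈ range N, i (j + 1) +
        ((N : R) + 1) * ∑ j ∈ range n, i (j + 1) := by
    intro n hn
    induction n with
    | zero => simp
    | succ n ih =>
      have h := ih (by omega)
      have h' := mul_inv_succ_sub hi he (k := N - (n + 1) + 1) (l := n + 1)
        (by omega) (by omega) (by omega)
      rw [show N - n = N - (n + 1) + 1 by omega, sum_range_succ] at h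
      rw [sum_range_succ]
      linear_combination h - h'
  have h := key N le_rfl
  have h2 := hi 2 (by omega) hN
  rw [Nat.sub_self, sum_range_zero] at h
  push_cast at h2
  rw [key n hn]
  linear_combination (-i 2) * h - ((N : R) + 1) * (∑ j ∈ range N, i (j + 1)) * h2

end

section

variable {R : Type*} [CommRing R] {m : ℕ} {i : ℕ → R}

theorem mul_harmonic_third (hi : ∀ k, 1 ≤ k → k ≤ 6 * m → (k : R) * i k = 1) (hm : 1 ≤ m)
    (he : (((6 * m : ℕ) : R) + 1) ^ 2 = 0) :
    (((6 * m : ℕ) : R) + 1) * ∑ j ∈ range (2 * m), i (j + 1) =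
      (((6 * m : ℕ) : R) + 1) * ∑ j ∈ range m, i (j + 1) -
        (((6 * m : ℕ) : R) + 1) * ∑ j ∈ range (3 * m), i (j + 1) := by
  have h2 := hi 2 (by omega) (by omega)
  have hdouble : ∀ k, 1 ≤ k → 2 * k ≤ 6 * m → i (2 * k) = i 2 * i k := by
    intro k hk hkm
    have h1 := hi k hk (by omega)
    have h3 := hi (2 * k) (by omega) hkm
    push_cast at h2 h3
    linear_combination i 2 * i k * h3 - i (2 * k) * h1 - i (2 * k) * k * i k * h2
  have key : ∀ n ≤ m, (((6 * m : ℕ) : R) + 1) * ∑ j ∈ range (2 * n), i (j + 1) =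
      (((6 * m : ℕ) : R) + 1) * i 2 * (∑ j ∈ range n, i (j + 1) -
        (∑ j ∈ range (3 * m), i (j + 1) - ∑ j ∈ range (3 * m - n), i (j + 1))) := by
    intro n hn
    induction n with
    | zero => simp
    | succ n ih =>
      have h := ih (by omega)
      have h' := mul_inv_succ_sub hi he (k := 2 * n + 1) (l := 2 * (3 * m - (n + 1) + 1))
        (by omega) (by omega) (by omega)
      rw [hdouble _ (by omega) (by omega)] at h'
      have h4 := hdouble (n + 1) (by omega) (by omega)
      rw [show 3 * m - n = 3 * m - (n + 1) + 1 by omega, sum_range_succ _ (3 * m - (n + 1))] at h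
      rw [show 2 * (n + 1) = 2 * n + 1 + 1 by ring, sum_range_succ, sum_range_succ,
        sum_range_succ _ n]
      rw [show 2 * (n + 1) = 2 * n + 1 + 1 by ring] at h4
      linear_combination h + h' + (((6 * m : ℕ) : R) + 1) * h4
  have h := key m le_rfl
  rw [show 3 * m - m = 2 * m by omega] at h
  push_cast at h2 h ⊢
  linear_combination 2 * h + (6 * (m : R) + 1) * (∑ j ∈ range m, i (j + 1) -
    (∑ j ∈ range (3 * m), i (j + 1) - ∑ j ∈ range (2 * m), i (j + 1))) * h2

theorem isUnit_factorial_natCast {N : ℕ} (hi : ∀ k, 1 ≤ k → k ≤ N → (k : R) * i k = 1) {n : ℕ}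
    (hn : n ≤ N) : IsUnit (n.factorial : R) := by
  induction n with
  | zero => simp
  | succ n ih =>
    rw [Nat.factorial_succ, Nat.cast_mul]
    exact (IsUnit.of_mul_eq_one _ (hi (n + 1) (by omega) hn)).mul (ih (by omega))

theorem factorial_eq_mul_factorial_sub {N : ℕ} (hi : ∀ k, 1 ≤ k → k ≤ N → (k : R) * i k = 1)
    (he : ((N : R) + 1) ^ 2 = 0) {n : ℕ} (hn : n ≤ N) :
    (N.factorial : R) = (-1) ^ n * ((n.factorial : R) *
      (1 - ((N : R) + 1) * ∑ j ∈ range n, i (j + 1))) * ((N - n).factorial : R) := by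
  have h := prod_sub_mul_natCast_eq_of_sq_eq_zero hi (b := 1) (c := 1) (one_mul 1) he hn
  simp only [one_mul] at h
  rw [← h, prod_succ_sub_mul_factorial hn]

theorem four_pow_eq_one_sub_mul_harmonic {n : ℕ}
    (hi : ∀ k, 1 ≤ k → k ≤ 2 * n → (k : R) * i k = 1) (hn : 1 ≤ n)
    (he : (((2 * n : ℕ) : R) + 1) ^ 2 = 0) :
    (4 : R) ^ (2 * n) = 1 - (((2 * n : ℕ) : R) + 1) * ∑ j ∈ range n, i (j + 1) := by
  have h2 := hi 2 (by omega) (by omega)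
  have h1 := factorial_eq_mul_factorial_sub hi he (n := n) (by omega)
  have h3 := factorial_two_mul_eq_prod (R := R) n
  have h4 := prod_sub_mul_natCast_eq_of_sq_eq_zero hi (b := 2) (c := i 2) (by exact_mod_cast h2)
    he (n := n) (by omega)
  have hF := isUnit_factorial_natCast hi (n := n) (by omega)
  have hs : IsUnit ((-1 : R) ^ n) := (isUnit_one.neg).pow n
  rw [show 2 * n - n = n by omega] at h1
  rw [show (2 * (n : R) + 1) = ((2 * n : ℕ) : R) + 1 by push_cast; ring, h4, h1,
    show (-2 : R) = -1 * 2 by ring, mul_pow] at h3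
  generalize ((2 * n : ℕ) : R) + 1 = e at *
  generalize ∑ j ∈ range n, i (j + 1) = H at *
  generalize (n.factorial : R) = F at *
  have h5 : (2 : R) ^ (2 * n) * (1 - i 2 * e * H) = 1 - e * H := by
    apply (hs.mul (hF.mul hF)).mul_left_cancel
    rw [two_mul, pow_add]
    linear_combination -h3
  push_cast at h2
  have h6 : (2 : R) ^ (2 * n) = 1 - i 2 * e * H := by
    linear_combination (1 + i 2 * e * H) * h5 + ((2 : R) ^ (2 * n) * i 2 ^ 2 * H ^ 2 -
      i 2 * H ^ 2) * he + e * H * h2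
  rw [show (4 : R) = 2 ^ 2 by norm_num, ← pow_mul, mul_comm 2, pow_mul, h6]
  linear_combination (i 2 ^ 2 * H ^ 2) * he - e * H * h2

theorem four_pow_mul_factorial_eq (hi : ∀ k, 1 ≤ k → k ≤ 6 * m → (k : R) * i k = 1)
    (hm : 1 ≤ m) (he : (((6 * m : ℕ) : R) + 1) ^ 2 = 0) :
    (4 : R) ^ (6 * m) * ((-1) ^ m * (m.factorial : R) * ((5 * m).factorial : R)) =
      ((4 * m).factorial : R) * ((2 * m).factorial : R) := by
  have h1 := factorial_eq_mul_factorial_sub hi he (n := m) (by omega)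
  have h2 := factorial_eq_mul_factorial_sub hi he (n := 2 * m) (by omega)
  have h3 := mul_harmonic_third hi hm he
  have h4 : (4 : R) ^ (6 * m) = 1 - (((6 * m : ℕ) : R) + 1) * ∑ j ∈ range (3 * m), i (j + 1) := by
    have h6 : 6 * m = 2 * (3 * m) := by ring
    rw [h6] at hi he ⊢
    exact four_pow_eq_one_sub_mul_harmonic hi (by omega) he
  rw [show 6 * m - m = 5 * m by omega] at h1
  rw [show 6 * m - 2 * m = 4 * m by omega, pow_mul, neg_one_sq, one_pow, one_mul, h1] at h2
  rw [h4]
  generalize ((6 * m : ℕ) : R) + 1 = e at *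
  generalize ∑ j ∈ range m, i (j + 1) = H at *
  generalize ∑ j ∈ range (2 * m), i (j + 1) = H' at *
  generalize ∑ j ∈ range (3 * m), i (j + 1) = H'' at *
  generalize ((4 * m).factorial : R) = F4 at *
  generalize ((2 * m).factorial : R) = F2 at *
  generalize ((5 * m).factorial : R) = F5 at *
  generalize (m.factorial : R) = F1 at *
  generalize (-1 : R) ^ m = s at *
  have h5 : s * F1 * F5 * (1 - e * H'') * (1 - e * H') = F4 * F2 * (1 - e * H') := by
    linear_combination h2 + s * F1 * F5 * H' * H'' * he - s * F1 * F5 * h3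
  linear_combination (1 + e * H') * h5 +
    (s * F1 * F5 * (1 - e * H'') - F4 * F2) * H' ^ 2 * he

theorem two_pow_mul_prod_eq (hi : ∀ k, 1 ≤ k → k ≤ 6 * m → (k : R) * i k = 1)
    (hm : 1 ≤ m) (he : (((6 * m : ℕ) : R) + 1) ^ 2 = 0) :
    (2 : R) ^ (6 * m) * ((∏ j ∈ range m, (((6 * m : ℕ) : R) + 1 - 6 * (j + 1))) *
        ∏ j ∈ range (5 * m), (((6 * m : ℕ) : R) + 1 - (-6) * (j + 1))) =
      (∏ j ∈ range (4 * m), (2 * (((6 * m : ℕ) : R) + 1) - 3 * (j + 1))) *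
        ∏ j ∈ range (2 * m), (2 * (((6 * m : ℕ) : R) + 1) - (-3) * (j + 1)) := by
  have h6 : (6 : R) * i 6 = 1 := by exact_mod_cast hi 6 (by omega) (by omega)
  have h3 : (3 : R) * i 3 = 1 := by exact_mod_cast hi 3 (by omega) (by omega)
  have he2 : (2 * (((6 * m : ℕ) : R) + 1)) ^ 2 = 0 := by linear_combination 4 * he
  have hH1 := mul_harmonic_sub hi (by omega) he (n := m) (by omega)
  have hH2 := mul_harmonic_sub hi (by omega) he (n := 2 * m) (by omega)
  have key := four_pow_mul_factorial_eq hi hm he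
  rw [show 6 * m - m = 5 * m by omega] at hH1
  rw [show 6 * m - 2 * m = 4 * m by omega] at hH2
  rw [prod_sub_mul_natCast_eq_of_sq_eq_zero hi h6 he (by omega),
    prod_sub_mul_natCast_eq_of_sq_eq_zero hi (b := -6) (c := -i 6) (by rw [neg_mul_neg, h6]) he
      (by omega),
    prod_sub_mul_natCast_eq_of_sq_eq_zero hi h3 he2 (by omega),
    prod_sub_mul_natCast_eq_of_sq_eq_zero hi (b := -3) (c := -i 3) (by rw [neg_mul_neg, h3]) he2
      (by omega), neg_neg, neg_neg]
  have e1 : (2 : R) ^ (6 * m) * ((-6) ^ m * 6 ^ (5 * m)) = 3 ^ (6 * m) * 4 ^ (6 * m) * (-1) ^ m := by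
    rw [← mul_pow, show (3 * 4 : R) = 2 * 6 by norm_num, mul_pow,
      show (-6 : R) = -1 * 6 by ring, mul_pow, show 6 * m = m + 5 * m by ring, pow_add (6 : R)]
    ring
  have e2 : (-3 : R) ^ (4 * m) * 3 ^ (2 * m) = 3 ^ (6 * m) := by
    rw [(show Even (4 * m) from ⟨2 * m, by ring⟩).neg_pow, ← pow_add]
    congr 1
    ring
  generalize ((6 * m : ℕ) : R) + 1 = e at *
  generalize ∑ j ∈ range m, i (j + 1) = H1 at *
  generalize ∑ j ∈ range (5 * m), i (j + 1) = H5 at *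
  generalize ∑ j ∈ range (2 * m), i (j + 1) = H2 at *
  generalize ∑ j ∈ range (4 * m), i (j + 1) = H4 at *
  have e3 : (1 - i 6 * e * H1) * (1 - -i 6 * e * H5) = 1 := by
    linear_combination i 6 * hH1 - i 6 ^ 2 * H1 * H5 * he
  have e4 : (1 - i 3 * (2 * e) * H4) * (1 - -i 3 * (2 * e) * H2) = 1 := by
    linear_combination (-2 * i 3) * hH2 - 4 * i 3 ^ 2 * H2 * H4 * he
  calc _ = ((2 : R) ^ (6 * m) * ((-6) ^ m * 6 ^ (5 * m))) * (m.factorial * (5 * m).factorial) *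
        ((1 - i 6 * e * H1) * (1 - -i 6 * e * H5)) := by ring
    _ = 3 ^ (6 * m) * ((4 : R) ^ (6 * m) * ((-1) ^ m * m.factorial * (5 * m).factorial)) := by
      rw [e1, e3]; ring
    _ = ((-3 : R) ^ (4 * m) * 3 ^ (2 * m)) * ((4 * m).factorial * (2 * m).factorial) *
        ((1 - i 3 * (2 * e) * H4) * (1 - -i 3 * (2 * e) * H2)) := by
      rw [key, e2, e4]; ring
    _ = _ := by ring

end

/-- Splitting an arithmetic progression at its term `a`. -/
theorem prod_range_arith_split {R : Type*} [CommRing R] (a b : R) (k l : ℕ) :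
    ∏ j ∈ range (k + 1 + l), (a - b * k + b * j) =
      a * ((∏ j ∈ range k, (a - b * (j + 1))) * ∏ j ∈ range l, (a - (-b) * (j + 1))) := by
  rw [prod_range_add, prod_range_succ, ← prod_range_reflect]
  have h1 : ∏ j ∈ range k, (a - b * k + b * ((k - 1 - j : ℕ) : R)) =
      ∏ j ∈ range k, (a - b * (j + 1)) := by
    refine prod_congr rfl fun j hj ↦ ?_
    obtain ⟨r, rfl⟩ := Nat.exists_eq_add_of_lt (mem_range.mp hj)
    rw [show j + r + 1 - 1 - j = r by omega]
    push_cast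
    ring
  have h2 : ∏ j ∈ range l, (a - b * k + b * ((k + 1 + j : ℕ) : R)) =
      ∏ j ∈ range l, (a - (-b) * (j + 1)) := by
    refine prod_congr rfl fun j _ ↦ ?_
    push_cast
    ring
  rw [h1, h2]
  ring

theorem pow_mul_ascPochhammer_eval {K : Type*} [CommRing K] {x b a : K} (h : b * x = a) (n : ℕ) :
    b ^ n * (ascPochhammer K n).eval x = ∏ j ∈ range n, (a + b * j) := by
  induction n with
  | zero => simp
  | succ n ih =>
    rw [ascPochhammer_succ_eval, prod_range_succ, ← ih]
    linear_combination b ^ n * (ascPochhammer K n).eval x * h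

theorem cube_dvd_two_pow_mul_prod_sub (p : ℕ) (hp : p.Prime) (h6 : p % 6 = 1) :
    ((p ^ 3 : ℕ) : ℤ) ∣ 2 ^ p * ∏ j ∈ range p, (1 + 6 * (j : ℤ)) -
      ∏ j ∈ range p, (2 + 3 * (j : ℤ)) := by
  obtain ⟨m, rfl⟩ : ∃ m, p = 6 * m + 1 := ⟨p / 6, by omega⟩
  have hm : 1 ≤ m := by
    rcases Nat.eq_zero_or_pos m with rfl | h
    · exact absurd hp (by norm_num)
    · exact h
  have hi : ∀ k, 1 ≤ k → k ≤ 6 * m →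
      (k : ZMod ((6 * m + 1) ^ 2)) * (k : ZMod ((6 * m + 1) ^ 2))⁻¹ = 1 := by
    intro k hk hkm
    exact ZMod.coe_mul_inv_eq_one k
      ((Nat.coprime_of_lt_prime (by omega) (by omega) hp).symm.pow_right 2)
  have he : (((6 * m : ℕ) : ZMod ((6 * m + 1) ^ 2)) + 1) ^ 2 = 0 := by
    exact_mod_cast ZMod.natCast_self ((6 * m + 1) ^ 2)
  have key := two_pow_mul_prod_eq hi hm he
  have hA := prod_range_arith_split (6 * m + 1 : ℤ) 6 m (5 * m)
  have hB := prod_range_arith_split (2 * (6 * m + 1) : ℤ) 3 (4 * m) (2 * m)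
  rw [show m + 1 + 5 * m = 6 * m + 1 by ring, add_sub_cancel_left] at hA
  rw [show 4 * m + 1 + 2 * m = 6 * m + 1 by ring,
    show (2 * (6 * m + 1) : ℤ) - 3 * (4 * m : ℕ) = 2 by push_cast; ring] at hB
  rw [hA, hB]
  have hd : (((6 * m + 1) ^ 2 : ℕ) : ℤ) ∣
      2 ^ (6 * m) * ((∏ j ∈ range m, ((6 * m + 1 : ℤ) - 6 * (j + 1))) *
        ∏ j ∈ range (5 * m), ((6 * m + 1 : ℤ) - (-6) * (j + 1))) -
      (∏ j ∈ range (4 * m), (2 * (6 * m + 1 : ℤ) - 3 * (j + 1))) *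
        ∏ j ∈ range (2 * m), (2 * (6 * m + 1 : ℤ) - (-3) * (j + 1)) := by
    rw [← ZMod.intCast_zmod_eq_zero_iff_dvd]
    push_cast at key ⊢
    rw [key, sub_self]
  obtain ⟨c, hc⟩ := hd
  refine ⟨2 * c, ?_⟩
  push_cast at hc ⊢
  linear_combination 2 * (6 * m + 1 : ℤ) * hc

/-- For every prime `p ≡ 1 (mod 6)`, `4^p (1/6)_p ≡ (2/3)_p (mod p^3)` as rationals. -/
theorem poch_sixth_cong (p : ℕ) (hp : p.Prime) (h6 : p % 6 = 1) :
    padicNorm p ((4 : ℚ) ^ p * (ascPochhammer ℚ p).eval (1/6) - (ascPochhammer ℚ p).eval (2/3))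
      ≤ (p : ℚ) ^ (-(3 : ℤ)) := by
  have := Fact.mk hp
  have hA := pow_mul_ascPochhammer_eval (show (6 : ℚ) * (1 / 6) = 1 by norm_num) p
  have hB := pow_mul_ascPochhammer_eval (show (3 : ℚ) * (2 / 3) = 2 by norm_num) p
  have h := padicNorm.dvd_iff_norm_le.mp (cube_dvd_two_pow_mul_prod_sub p hp h6)
  have h3 : padicNorm p ((3 : ℚ) ^ p) = 1 := by
    have : ¬ p ∣ 3 ^ p := fun hd ↦ by
      have := (Nat.prime_dvd_prime_iff_eq hp Nat.prime_three).mp (hp.dvd_of_dvd_pow hd)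
      omega
    exact_mod_cast (padicNorm.nat_eq_one_iff (p := p) (3 ^ p)).mpr this
  have e : (3 : ℚ) ^ p * (4 ^ p * (ascPochhammer ℚ p).eval (1 / 6) -
      (ascPochhammer ℚ p).eval (2 / 3)) =
      2 ^ p * ∏ j ∈ range p, (1 + 6 * (j : ℚ)) - ∏ j ∈ range p, (2 + 3 * (j : ℚ)) := by
    have h12 : (3 : ℚ) ^ p * 4 ^ p = 2 ^ p * 6 ^ p := by
      rw [← mul_pow, ← mul_pow]
      norm_num
    rw [← hA, ← hB]
    linear_combination (ascPochhammer ℚ p).eval (1 / 6) * h12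
  calc _ = padicNorm p (3 ^ p * (4 ^ p * (ascPochhammer ℚ p).eval (1 / 6) -
        (ascPochhammer ℚ p).eval (2 / 3))) := by rw [padicNorm.mul, h3, one_mul]
    _ ≤ _ := by
      rw [e]
      exact_mod_cast h
end

section
/- For every prime p with p ≡ 1 (mod 6), 108^p·(1/6)_p·(1/3)_p/(p!)^2 ≡ C(3p,p)·C(2p,p) (mod p^2). -/
open Finset in
/-- First-order expansion of `∏ (a i + y)` in `y`, with the linear coefficient identified modulo
a prime not dividing any `a i`. -/
lemma exists_prod_add_eq {ι : Type*} {p : ℕ} [Fact p.Prime] (S : Finset ι) (a : ι → ℤ) (y : ℤ)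
    (ha : ∀ i ∈ S, (a i : ZMod p) ≠ 0) :
    ∃ D K : ℤ, ∏ i ∈ S, (a i + y) = ∏ i ∈ S, a i + y * D + y ^ 2 * K ∧
      (D : ZMod p) = (∏ i ∈ S, (a i : ZMod p)) * ∑ i ∈ S, (a i : ZMod p)⁻¹ := by
  classical
  induction S using Finset.induction_on with
  | empty => exact ⟨0, 0, by simp, by simp⟩
  | insert i S hi ih =>
    obtain ⟨D, K, h, hD⟩ := ih fun j hj => ha j (mem_insert_of_mem hj)
    have h0 := ha i (mem_insert_self i S)
    refine ⟨∏ j ∈ S, a j + a i * D, D + a i * K + y * K, ?_, ?_⟩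
    · rw [prod_insert hi, prod_insert hi, h]
      ring
    · rw [prod_insert hi, sum_insert hi]
      push_cast
      rw [hD]
      field_simp

/-- The inverses of the residues modulo a prime `p > 3` sum to zero. -/
lemma ZMod.sum_inv_eq_zero {p : ℕ} [Fact p.Prime] (hp : 3 < p) : ∑ x : ZMod p, x⁻¹ = 0 := by
  have h := FiniteField.sum_pow_lt_card_sub_one (ZMod p) 1 (by rw [ZMod.card]; omega)
  rw [← h]
  simpa using Equiv.sum_comp (Equiv.inv (ZMod p)) fun x => x

open Finset in
lemma ZMod.sum_range_linear_inv_eq_zero {p : ℕ} [Fact p.Prime] (hp : 3 < p) {d : ZMod p}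
    (hd : d ≠ 0) (r : ZMod p) : ∑ k ∈ range p, (d * (k : ZMod p) + r)⁻¹ = 0 := by
  have h1 : ∑ k ∈ range p, (d * (k : ZMod p) + r)⁻¹ = ∑ x : ZMod p, (d * x + r)⁻¹ := by
    refine sum_nbij' (fun k => (k : ZMod p)) ZMod.val (by simp) ?_ ?_ ?_ ?_
    · intro x _
      simpa using ZMod.val_lt x
    · intro k hk
      exact ZMod.val_cast_of_lt (by simpa using hk)
    · simp
    · simp
  rw [h1, ← ZMod.sum_inv_eq_zero hp]
  exact Equiv.sum_comp ((Equiv.mulLeft₀ d hd).trans (Equiv.addRight r)) fun x => x⁻¹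

open Finset in
/-- Shifting an arithmetic progression of length `p`, with its multiple of `p` removed, by a
multiple of `p` does not change its product modulo `p ^ 2`. -/
lemma prod_erase_add_modEq {p : ℕ} [Fact p.Prime] (hp : 3 < p) {d : ℤ} (hd : ¬ (p : ℤ) ∣ d)
    (r u : ℤ) {c : ℕ} (hc : c < p) (hcr : (p : ℤ) ∣ d * c + r) :
    ∏ k ∈ (range p).erase c, (d * k + r + p * u) ≡ ∏ k ∈ (range p).erase c, (d * k + r)
      [ZMOD p ^ 2] := by
  have hd' : (d : ZMod p) ≠ 0 := by rwa [Ne, ZMod.intCast_zmod_eq_zero_iff_dvd]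
  have hcr' : (d : ZMod p) * c + r = 0 := by
    have := (ZMod.intCast_zmod_eq_zero_iff_dvd _ p).mpr hcr
    push_cast at this
    exact this
  have hne : ∀ k ∈ (range p).erase c, ((d * k + r : ℤ) : ZMod p) ≠ 0 := by
    intro k hk h
    obtain ⟨hkc, hk⟩ := mem_erase.mp hk
    push_cast at h
    rw [← hcr', add_left_inj] at h
    have := mul_left_cancel₀ hd' h
    rw [ZMod.natCast_eq_natCast_iff'] at this
    rw [Nat.mod_eq_of_lt (mem_range.mp hk), Nat.mod_eq_of_lt hc] at this
    exact hkc this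
  obtain ⟨D, K, h, hD⟩ := exists_prod_add_eq _ (fun k : ℕ => d * k + r) (p * u) hne
  have hs : ∑ k ∈ (range p).erase c, (((d * k + r : ℤ) : ZMod p))⁻¹ = 0 := by
    rw [← ZMod.sum_range_linear_inv_eq_zero hp hd' r, ← add_sum_erase _ _ (mem_range.mpr hc), hcr']
    simp
  rw [hs, mul_zero, ZMod.intCast_zmod_eq_zero_iff_dvd] at hD
  obtain ⟨E, rfl⟩ := hD
  rw [h]
  refine (Int.modEq_iff_dvd.mpr ⟨u * E + u ^ 2 * K, ?_⟩).symm
  ring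

open Finset in
lemma prod_three_mul_add_one_mul (n : ℕ) :
    (∏ k ∈ range n, (3 * (k : ℤ) + 1)) * (∏ k ∈ range n, (3 * (k : ℤ) + 2)) * (3 ^ n * n.factorial)
      = (3 * n).factorial := by
  induction n with
  | zero => simp
  | succ n ih =>
    rw [show 3 * (n + 1) = 3 * n + 1 + 1 + 1 by ring]
    simp only [Nat.factorial_succ, prod_range_succ]
    push_cast
    rw [← ih]
    ring

open Finset in
lemma prod_six_mul_add_one_mul (n : ℕ) :
    (∏ k ∈ range n, (6 * (k : ℤ) + 1)) * (2 ^ n * ∏ k ∈ range n, (3 * (k : ℤ) + 2))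
      = ∏ k ∈ range (2 * n), (3 * (k : ℤ) + 1) := by
  induction n with
  | zero => simp
  | succ n ih =>
    rw [show 2 * (n + 1) = 2 * n + 1 + 1 by ring]
    simp only [prod_range_succ]
    push_cast
    rw [← ih]
    ring

open Finset in
lemma ascPochhammer_eval_one_div (n : ℕ) {d : ℚ} (hd : d ≠ 0) :
    d ^ n * (ascPochhammer ℚ n).eval (1 / d) = ∏ k ∈ range n, (d * (k : ℚ) + 1) := by
  induction n with
  | zero => simp
  | succ n ih =>
    rw [prod_range_succ, ← ih, ascPochhammer_succ_eval]
    field_simp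
    ring

open Finset in
/-- The congruence after clearing denominators and removing the multiples of `p`. -/
lemma modEq_of_mod_six {p : ℕ} [Fact p.Prime] (h6 : p % 6 = 1) :
    ∃ G H H' : ℤ, ∏ k ∈ range p, (6 * (k : ℤ) + 1) = p * G ∧
      ∏ k ∈ range p, (3 * (k : ℤ) + 1) = p * H ∧
      ∏ k ∈ range p, (3 * (k : ℤ) + 2) = 2 * p * H' ∧
      6 ^ p * (G * H) ≡ 2 * 3 ^ p * (H * H') [ZMOD p ^ 2] := by
  have hpp : p.Prime := Fact.out
  obtain ⟨m, hm⟩ : ∃ m, p = 6 * m + 1 := ⟨p / 6, by omega⟩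
  have hm0 : 0 < m := Nat.pos_of_ne_zero fun h => hpp.ne_one (by simp [hm, h])
  have hp3 : 3 < p := by omega
  have hpm : (p : ℤ) = 6 * m + 1 := by exact_mod_cast hm
  have hdvd {d : ℕ} (h0 : 0 < d) (h : d < p) : ¬ (p : ℤ) ∣ d := fun hd =>
    Nat.not_dvd_of_pos_of_lt h0 h (by exact_mod_cast hd)
  set G : ℤ := ∏ k ∈ (range p).erase m, (6 * (k : ℤ) + 1)
  set H : ℤ := ∏ k ∈ (range p).erase (2 * m), (3 * (k : ℤ) + 1)
  set H' : ℤ := ∏ k ∈ (range p).erase (4 * m), (3 * (k : ℤ) + 2)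
  set J : ℤ := ∏ k ∈ (range p).erase (2 * m), (3 * (k : ℤ) + 1 + p * 3) with hJ
  have e1 : ∏ k ∈ range p, (6 * (k : ℤ) + 1) = p * G := by
    rw [← mul_prod_erase _ _ (mem_range.mpr (show m < p by omega)), hpm]
  have e2 : ∏ k ∈ range p, (3 * (k : ℤ) + 1) = p * H := by
    rw [← mul_prod_erase _ _ (mem_range.mpr (show 2 * m < p by omega)), hpm]
    push_cast
    ring
  have e3 : ∏ k ∈ range p, (3 * (k : ℤ) + 2) = 2 * p * H' := by
    rw [← mul_prod_erase _ _ (mem_range.mpr (show 4 * m < p by omega)), hpm]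
    push_cast
    ring
  have e4 : ∏ k ∈ range p, (3 * (k : ℤ) + 1 + p * 3) = 4 * p * J := by
    rw [← mul_prod_erase _ _ (mem_range.mpr (show 2 * m < p by omega)), ← hJ]
    congr 1
    rw [hpm]
    push_cast
    ring
  refine ⟨G, H, H', e1, e2, e3, ?_⟩
  have hc : (p : ℤ) ∣ 3 * ((2 * m : ℕ) : ℤ) + 1 := ⟨1, by rw [hpm]; push_cast; ring⟩
  have hJH : J ≡ H [ZMOD p ^ 2] :=
    prod_erase_add_modEq hp3 (hdvd (d := 3) (by omega) hp3) 1 3 (by omega) hc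
  have hH'H : H' ≡ H [ZMOD p ^ 2] := by
    have h1 := prod_erase_add_modEq hp3 (hdvd (d := 3) (by omega) hp3) 1 (-3)
      (show 2 * m < p by omega) hc
    have h2 : H' = ∏ k ∈ (range p).erase (2 * m), -(3 * (k : ℤ) + 1 + p * (-3)) := by
      refine prod_nbij' (fun k => p - 1 - k) (fun k => p - 1 - k) ?_ ?_ ?_ ?_ ?_
      · simp only [mem_erase, mem_range]; omega
      · simp only [mem_erase, mem_range]; omega
      · simp only [mem_erase, mem_range]; omega
      · simp only [mem_erase, mem_range]; omega
      · simp only [mem_erase, mem_range]; omega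
    rw [prod_neg, card_erase_of_mem (mem_range.mpr (by omega)), card_range,
      Even.neg_one_pow ⟨3 * m, by omega⟩, one_mul] at h2
    rw [h2]
    exact h1
  have hHp : IsCoprime H' ((p : ℤ) ^ 2) := by
    refine IsCoprime.pow_right (IsCoprime.prod_left fun k hk => ?_)
    obtain ⟨hk, hkp⟩ := mem_erase.mp hk
    rw [mem_range] at hkp
    refine ((Nat.prime_iff_prime_int.mp hpp).coprime_iff_not_dvd.mpr fun hd => ?_).symm
    have h1 : (p : ℤ) ∣ 3 * ((k : ℤ) - (4 * m : ℕ)) := by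
      have : 3 * ((k : ℤ) - (4 * m : ℕ)) = 3 * (k : ℤ) + 2 - p * 2 := by
        rw [hpm]; push_cast; ring
      rw [this]
      exact hd.sub (dvd_mul_right _ _)
    rcases (Nat.prime_iff_prime_int.mp hpp).dvd_or_dvd h1 with h | h
    · exact hdvd (d := 3) (by omega) hp3 h
    · have := Int.eq_zero_of_abs_lt_dvd h (by rw [abs_lt]; omega)
      omega
  have hGH : 2 ^ p * G * H' = 2 * H * J := by
    have h := prod_six_mul_add_one_mul p
    rw [two_mul p, prod_range_add, e1, e3, e2] at h
    have h' : ∏ x ∈ range p, (3 * ((p + x : ℕ) : ℤ) + 1) = 4 * p * J := by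
      rw [← e4]
      refine prod_congr rfl fun k _ => ?_
      push_cast
      ring
    rw [h'] at h
    have hp0 : (2 * (p : ℤ) ^ 2) ≠ 0 := by
      have := hpp.ne_zero
      positivity
    refine mul_left_cancel₀ hp0 ?_
    linear_combination h
  have hkey : 2 ^ p * G ≡ 2 * H' [ZMOD p ^ 2] := by
    have h : 2 ^ p * G * H' ≡ 2 * H' * H' [ZMOD p ^ 2] := by
      rw [hGH]
      exact ((hH'H.symm.mul_left 2).mul (hJH.trans hH'H.symm))
    rw [Int.modEq_iff_dvd, ← sub_mul] at h
    exact Int.modEq_iff_dvd.mpr (hHp.symm.dvd_of_dvd_mul_right h)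
  have h := hkey.mul_left (3 ^ p * H)
  convert h using 1
  · rw [show (6 : ℤ) = 2 * 3 by norm_num, mul_pow]
    ring
  · ring

/-- For every prime `p ≡ 1 (mod 6)`,
`108^p (1/6)_p (1/3)_p/(p!)^2 ≡ C(3p,p) C(2p,p) (mod p^2)`. -/
theorem t_p_choose_cong (p : ℕ) (hp : p.Prime) (h6 : p % 6 = 1) :
    padicNorm p
      ((108 : ℚ) ^ p * (ascPochhammer ℚ p).eval (1/6) * (ascPochhammer ℚ p).eval (1/3)
          / (p.factorial : ℚ) ^ 2
        - ((3 * p).choose p : ℚ) * ((2 * p).choose p : ℚ))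
      ≤ (p : ℚ) ^ (-(2 : ℤ)) := by
  have : Fact p.Prime := ⟨hp⟩
  obtain ⟨G, H, H', e1, e2, e3, h⟩ := modEq_of_mod_six h6
  obtain ⟨f, hf⟩ : ∃ f : ℚ, f = ((p - 1).factorial : ℚ) := ⟨_, rfl⟩
  have hf0 : f ≠ 0 := by rw [hf]; positivity
  have hp0 : (p : ℚ) ≠ 0 := by exact_mod_cast hp.ne_zero
  have hpf : (p.factorial : ℚ) = p * f := by
    rw [hf, ← Nat.mul_factorial_pred hp.ne_zero]
    push_cast
    rfl
  have hfn : padicNorm p f = 1 := by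
    rw [hf, padicNorm.nat_eq_one_iff, hp.dvd_factorial]
    have := hp.pos
    omega
  have ht : (108 : ℚ) ^ p * (ascPochhammer ℚ p).eval (1/6) * (ascPochhammer ℚ p).eval (1/3)
      = p ^ 2 * (6 ^ p * (G * H)) := by
    have h1 := ascPochhammer_eval_one_div p (d := 6) (by norm_num)
    have h2 := ascPochhammer_eval_one_div p (d := 3) (by norm_num)
    have e1' : ∏ k ∈ Finset.range p, (6 * (k : ℚ) + 1) = p * G := by exact_mod_cast e1
    have e2' : ∏ k ∈ Finset.range p, (3 * (k : ℚ) + 1) = p * H := by exact_mod_cast e2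
    rw [e1'] at h1
    rw [e2'] at h2
    rw [show (108 : ℚ) = 6 * 6 * 3 by norm_num, mul_pow, mul_pow]
    linear_combination (6 ^ p * (3 ^ p * (ascPochhammer ℚ p).eval (1/3))) * h1 +
      6 ^ p * (p * G) * h2
  have hc : ((3 * p).choose p : ℚ) * ((2 * p).choose p : ℚ) * (p * f) ^ 2
      = p ^ 2 * (2 * 3 ^ p * (H * H')) := by
    have h1 := prod_three_mul_add_one_mul p
    rw [e2, e3] at h1
    have h1' : (p * H : ℚ) * (2 * p * H') * (3 ^ p * p.factorial) = (3 * p).factorial := by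
      exact_mod_cast h1
    have h2 := Nat.choose_mul_factorial_mul_factorial (show p ≤ 3 * p by omega)
    have h3 := Nat.choose_mul_factorial_mul_factorial (show p ≤ 2 * p by omega)
    rw [show 3 * p - p = 2 * p by omega] at h2
    rw [show 2 * p - p = p by omega] at h3
    rw [← h2, ← h3] at h1'
    push_cast at h1'
    rw [hpf] at h1'
    refine mul_right_cancel₀ (mul_ne_zero hp0 hf0) ?_
    linear_combination -h1'
  have hmain : ((108 : ℚ) ^ p * (ascPochhammer ℚ p).eval (1/6) * (ascPochhammer ℚ p).eval (1/3)
          / (p.factorial : ℚ) ^ 2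
        - ((3 * p).choose p : ℚ) * ((2 * p).choose p : ℚ)) * (f * f)
      = ((6 ^ p * (G * H) - 2 * 3 ^ p * (H * H') : ℤ) : ℚ) := by
    have hc' : ((3 * p).choose p : ℚ) * ((2 * p).choose p : ℚ) * f ^ 2
        = 2 * 3 ^ p * (H * H') := by
      refine mul_left_cancel₀ (pow_ne_zero 2 hp0) ?_
      linear_combination hc
    rw [ht, hpf, sub_mul, mul_pow, mul_div_mul_left _ _ (pow_ne_zero 2 hp0), ← sq,
      div_mul_cancel₀ _ (pow_ne_zero 2 hf0), hc']
    push_cast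
    rfl
  have hn := congrArg (padicNorm p) hmain
  rw [padicNorm.mul, padicNorm.mul, hfn, mul_one, mul_one] at hn
  rw [hn]
  refine padicNorm.dvd_iff_norm_le.mp ?_
  push_cast
  exact h.symm.dvd
end
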